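/- arXiv:2510.02111 — 2 statements merged into one kernel-verified Lean document; each statement's English description precedes it below -/
import Mathlib

section
/- Let b ≥ 2 be an integer, e_1,…,e_d ∈ ℕ, and let f : [0,1)^d → ℝ be integrable. Let β^C_{u,k} denote the nested ANOVA component of f in the coarse base (b^{e_1},…,b^{e_d}) and β^U_{u,l} the nested ANOVA component of f in the usual base (b,…,b). Then for every nonempty u ⊆ {1,…,d}, every k = (k_j)_{j∈u} ∈ ℕ_0^{|u|}, and every x ∈ [0,1)^d: β^C_{u,k}(x_u) = Σ_{l=(l_j)∈ℕ_0^{|u|}, e_j k_j ≤ l_j < e_j(k_j+1) for all j∈u} β^U_{u,l}(x_u). -/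
open Finset MeasureTheory

noncomputable section


/-- The unit cube `[0,1)^d`. -/
def unitCube (d : ℕ) : Set (Fin d → ℝ) := Set.univ.pi fun _ => Set.Ico (0 : ℝ) 1

/-- The box average `β̃_{u,v,k}(x_u)`: `m_{u,v,k}` times the integral of `f` over the set of
`y` in the unit cube whose coordinates `j ∈ u` lie in the same elementary interval
(of resolution `k_j + χ(j∈v)`) as `x_j`. -/
def betaTilde {d : ℕ} (b : Fin d → ℕ) (f : (Fin d → ℝ) → ℝ) (u v : Finset (Fin d))
    (k : Fin d → ℕ) (x : Fin d → ℝ) : ℝ :=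
  ((∏ j ∈ v, (b j : ℝ) ^ (k j + 1)) * ∏ j ∈ u \ v, (b j : ℝ) ^ k j) *
    ∫ y in unitCube d,
      if ∀ j ∈ u, ⌊(b j : ℝ) ^ (k j + if j ∈ v then 1 else 0) * y j⌋
          = ⌊(b j : ℝ) ^ (k j + if j ∈ v then 1 else 0) * x j⌋ then f y else 0

/-- The nested ANOVA component `β_{u,k}(x_u)` of `f` in base `b`. -/
def betaAnova {d : ℕ} (b : Fin d → ℕ) (f : (Fin d → ℝ) → ℝ) (u : Finset (Fin d))
    (k : Fin d → ℕ) (x : Fin d → ℝ) : ℝ :=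
  ∑ v ∈ u.powerset, (-1 : ℝ) ^ (u.card - v.card) * betaTilde b f u v k x

/-- The variance `σ²_{u,k}` of the nested ANOVA component `β_{u,k}` of `f` in base `b`. -/
def anovaVar {d : ℕ} (b : Fin d → ℕ) (f : (Fin d → ℝ) → ℝ) (u : Finset (Fin d))
    (k : Fin d → ℕ) : ℝ :=
  (∫ x in unitCube d, (betaAnova b f u k x) ^ 2) -
    (∫ x in unitCube d, betaAnova b f u k x) ^ 2

/-- The indicator that `t` lies in the elementary interval of resolution `n` in base `c`
containing `s`, normalized by `c ^ n`. -/
def cellKernel (c n : ℕ) (s t : ℝ) : ℝ :=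
  (c : ℝ) ^ n * if ⌊(c : ℝ) ^ n * t⌋ = ⌊(c : ℝ) ^ n * s⌋ then 1 else 0

theorem cellKernel_pow (c e n : ℕ) (s t : ℝ) :
    cellKernel (c ^ e) n s t = cellKernel c (e * n) s t := by
  simp only [cellKernel, Nat.cast_pow, pow_mul]

theorem abs_cellKernel_le (c n : ℕ) (s t : ℝ) : |cellKernel c n s t| ≤ (c : ℝ) ^ n := by
  unfold cellKernel
  split_ifs <;> simp [abs_of_nonneg]

theorem measurable_cellKernel (c n : ℕ) (s : ℝ) : Measurable (cellKernel c n s) := by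
  have hfloor : Measurable fun t : ℝ => ⌊(c : ℝ) ^ n * t⌋ :=
    Int.measurable_floor.comp (measurable_const_mul _)
  exact (Measurable.ite (hfloor (measurableSet_singleton _)) measurable_const
    measurable_const).const_mul _

theorem integrable_mul_prod_cellKernel {d : ℕ} (b : Fin d → ℕ) {f : (Fin d → ℝ) → ℝ}
    (hf : IntegrableOn f (unitCube d) volume) (u : Finset (Fin d)) (n : Fin d → ℕ)
    (x : Fin d → ℝ) :
    Integrable (fun y => f y * ∏ j ∈ u, cellKernel (b j) (n j) (x j) (y j))
      (volume.restrict (unitCube d)) := by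
  refine Integrable.mul_bdd (c := ∏ j ∈ u, (b j : ℝ) ^ n j) hf ?_ ?_
  · exact (Finset.measurable_prod u fun j _ =>
      (measurable_cellKernel _ _ _).comp (measurable_pi_apply j)).aestronglyMeasurable
  · refine Filter.Eventually.of_forall fun y => ?_
    rw [Real.norm_eq_abs, Finset.abs_prod]
    exact Finset.prod_le_prod (fun _ _ => abs_nonneg _) fun _ _ => abs_cellKernel_le _ _ _ _

theorem betaTilde_eq_integral {d : ℕ} (b : Fin d → ℕ) (f : (Fin d → ℝ) → ℝ)
    {u v : Finset (Fin d)} (hv : v ⊆ u) (k : Fin d → ℕ) (x : Fin d → ℝ) :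
    betaTilde b f u v k x = ∫ y in unitCube d,
      f y * ∏ j ∈ u, cellKernel (b j) (k j + if j ∈ v then 1 else 0) (x j) (y j) := by
  have hm : (∏ j ∈ v, (b j : ℝ) ^ (k j + 1)) * ∏ j ∈ u \ v, (b j : ℝ) ^ k j
      = ∏ j ∈ u, (b j : ℝ) ^ (k j + if j ∈ v then 1 else 0) := by
    rw [← Finset.prod_sdiff hv, mul_comm]
    congr 1 <;> refine Finset.prod_congr rfl fun j hj => ?_
    · simp [(Finset.mem_sdiff.mp hj).2]
    · simp [hj]
  rw [betaTilde, hm, ← integral_const_mul]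
  congr 1 with y
  simp only [cellKernel, Finset.prod_mul_distrib, Finset.prod_ite_zero, Finset.prod_const_one]
  split_ifs <;> ring

theorem prod_sub_eq_sum_powerset {ι : Type*} [DecidableEq ι] (u : Finset ι)
    (g : ι → ℕ → ℝ) (k : ι → ℕ) :
    ∏ j ∈ u, (g j (k j + 1) - g j (k j)) = ∑ v ∈ u.powerset,
      (-1 : ℝ) ^ (u.card - v.card) * ∏ j ∈ u, g j (k j + if j ∈ v then 1 else 0) := by
  simp only [sub_eq_add_neg]
  rw [Finset.prod_add]
  refine Finset.sum_congr rfl fun v hv => ?_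
  rw [Finset.mem_powerset] at hv
  rw [Finset.prod_neg, Finset.card_sdiff_of_subset hv, ← Finset.prod_sdiff hv,
    Finset.prod_congr rfl fun j hj => show g j (k j + if j ∈ v then 1 else 0) = g j (k j) by
      simp [(Finset.mem_sdiff.mp hj).2],
    Finset.prod_congr (s₁ := v) rfl fun j hj =>
      show g j (k j + if j ∈ v then 1 else 0) = g j (k j + 1) by simp [hj]]
  ring

theorem mul_prod_sub_cellKernel {d : ℕ} (b : Fin d → ℕ) (f : (Fin d → ℝ) → ℝ)
    (u : Finset (Fin d)) (k : Fin d → ℕ) (x y : Fin d → ℝ) :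
    f y * ∏ j ∈ u, (cellKernel (b j) (k j + 1) (x j) (y j) - cellKernel (b j) (k j) (x j) (y j))
      = ∑ v ∈ u.powerset, (-1 : ℝ) ^ (u.card - v.card) *
        (f y * ∏ j ∈ u, cellKernel (b j) (k j + if j ∈ v then 1 else 0) (x j) (y j)) := by
  rw [prod_sub_eq_sum_powerset u (fun j n => cellKernel (b j) n (x j) (y j)) k, Finset.mul_sum]
  exact Finset.sum_congr rfl fun v _ => mul_left_comm _ _ _

theorem integrable_mul_prod_sub_cellKernel {d : ℕ} (b : Fin d → ℕ) {f : (Fin d → ℝ) → ℝ}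
    (hf : IntegrableOn f (unitCube d) volume) (u : Finset (Fin d)) (k : Fin d → ℕ)
    (x : Fin d → ℝ) :
    Integrable (fun y => f y * ∏ j ∈ u,
        (cellKernel (b j) (k j + 1) (x j) (y j) - cellKernel (b j) (k j) (x j) (y j)))
      (volume.restrict (unitCube d)) := by
  simp only [mul_prod_sub_cellKernel]
  exact integrable_finsetSum _ fun v _ =>
    (integrable_mul_prod_cellKernel b hf u _ x).const_mul _

theorem betaAnova_eq_integral {d : ℕ} (b : Fin d → ℕ) {f : (Fin d → ℝ) → ℝ}
    (hf : IntegrableOn f (unitCube d) volume) (u : Finset (Fin d)) (k : Fin d → ℕ)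
    (x : Fin d → ℝ) :
    betaAnova b f u k x = ∫ y in unitCube d, f y * ∏ j ∈ u,
      (cellKernel (b j) (k j + 1) (x j) (y j) - cellKernel (b j) (k j) (x j) (y j)) := by
  simp only [mul_prod_sub_cellKernel]
  rw [integral_finsetSum _ fun v _ => (integrable_mul_prod_cellKernel b hf u _ x).const_mul _]
  refine Finset.sum_congr rfl fun v hv => ?_
  rw [integral_const_mul, betaTilde_eq_integral b f (Finset.mem_powerset.mp hv)]

theorem prod_sub_eq_sum_piFinset {ι : Type*} [Fintype ι] [DecidableEq ι] (u : Finset ι)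
    (g : ι → ℕ → ℝ) {m n : ι → ℕ} (hmn : ∀ j, m j ≤ n j) :
    ∏ j ∈ u, (g j (n j) - g j (m j)) =
      ∑ l ∈ Fintype.piFinset (fun j => if j ∈ u then Finset.Ico (m j) (n j) else {0}),
        ∏ j ∈ u, (g j (l j + 1) - g j (l j)) := by
  have hext (h : ι → ℝ) : ∏ j ∈ u, h j = ∏ j, if j ∈ u then h j else 1 := by
    rw [Finset.prod_ite_mem, Finset.univ_inter]
  simp only [hext]
  rw [← Finset.prod_univ_sum _ fun j l => if j ∈ u then g j (l + 1) - g j l else 1]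
  refine Finset.prod_congr rfl fun j _ => ?_
  by_cases hj : j ∈ u
  · simp only [hj, if_true]
    exact (Finset.sum_Ico_sub (g j) (hmn j)).symm
  · simp [hj]

theorem statement13 {d : ℕ} (hd : 1 ≤ d) (b : ℕ) (hb : 2 ≤ b)
    (e : Fin d → ℕ) (he : ∀ j, 1 ≤ e j)
    (f : (Fin d → ℝ) → ℝ) (hf : IntegrableOn f (unitCube d) volume)
    (u : Finset (Fin d)) (hu : u.Nonempty) (k : Fin d → ℕ)
    (x : Fin d → ℝ) (hx : ∀ j, x j ∈ Set.Ico (0 : ℝ) 1) :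
    betaAnova (fun j => b ^ e j) f u k x =
      ∑ l ∈ Fintype.piFinset
          (fun j => if j ∈ u then Finset.Ico (e j * k j) (e j * (k j + 1)) else {0}),
        betaAnova (fun _ => b) f u l x := by
  rw [betaAnova_eq_integral _ hf]
  simp only [betaAnova_eq_integral _ hf, cellKernel_pow]
  rw [← integral_finsetSum _ fun l _ =>
    integrable_mul_prod_sub_cellKernel (fun _ => b) hf u l x]
  congr 1 with y
  rw [← Finset.mul_sum, prod_sub_eq_sum_piFinset u (fun j n => cellKernel b n (x j) (y j))
    fun j => Nat.mul_le_mul_left (e j) (Nat.le_succ (k j))]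

end
end

section
/- Let S be an equidistributed sequence in base b = (b_1,…,b_d) and let P_n denote its first n points. Fix a nonempty u ⊆ {1,…,d}, v ⊆ u, and k ∈ ℕ_0^{|u|}, and set m_v := m_{u,v,k} and m_u := m_{u,u,k} = ∏_{j∈u} b_j^{k_j+1} (so m_v divides m_u). If n = q·m_u + r with q ∈ ℕ and 0 ≤ r < m_u, then C_{u,v,k}(P_n) = (q²·m_u² + 2·r·q·m_u)/m_v + C_{u,v,k}(P_r), where C_{u,v,k}(P_0) := 0. -/
open Finset MeasureTheory

noncomputable section


/-- `S` is an equidistributed sequence in base `b`: every point lies in `[0,1)^d` and,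
for all `r` and resolutions `k`, every elementary `k`-interval in base `b` contains
exactly one of the points `x_{rB}, …, x_{(r+1)B-1}` where `B = ∏ j, b j ^ k j`. -/
def IsEquidistributed {d : ℕ} (b : Fin d → ℕ) (S : ℕ → Fin d → ℝ) : Prop :=
  (∀ i j, S i j ∈ Set.Ico (0 : ℝ) 1) ∧
  ∀ (r : ℕ) (k : Fin d → ℕ) (a : Fin d → ℤ),
    (∀ j, 0 ≤ a j ∧ a j < (b j : ℤ) ^ k j) →
    ∃! i, i ∈ Finset.Ico (r * ∏ j, b j ^ k j) ((r + 1) * ∏ j, b j ^ k j) ∧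
      ∀ j, ⌊(b j : ℝ) ^ k j * S i j⌋ = a j

/-- `m_{u,v,k} = ∏_{j∈v} b_j^{k_j+1} ∏_{j∈u∖v} b_j^{k_j}`. -/
def mq {d : ℕ} (b : Fin d → ℕ) (u v : Finset (Fin d)) (k : Fin d → ℕ) : ℕ :=
  (∏ j ∈ v, b j ^ (k j + 1)) * ∏ j ∈ u \ v, b j ^ k j

/-- `C_{u,v,k}(P_n)`: number of ordered pairs of the first `n` points of `S` lying in the
same elementary interval of resolution `k_j + χ(j∈v)` in coordinate `j ∈ u`. -/
def Cq {d : ℕ} (b : Fin d → ℕ) (S : ℕ → Fin d → ℝ) (u v : Finset (Fin d))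
    (k : Fin d → ℕ) (n : ℕ) : ℕ :=
  ∑ i ∈ Finset.range n, ∑ i' ∈ Finset.range n,
    if ∀ j ∈ u, ⌊(b j : ℝ) ^ (k j + if j ∈ v then 1 else 0) * S i j⌋
        = ⌊(b j : ℝ) ^ (k j + if j ∈ v then 1 else 0) * S i' j⌋ then 1 else 0

/-- The gain coefficient `G_{u,k}(P_n)` of the first `n` points of `S` in base `b`. -/
def gain {d : ℕ} (b : Fin d → ℕ) (S : ℕ → Fin d → ℝ) (u : Finset (Fin d))
    (k : Fin d → ℕ) (n : ℕ) : ℝ :=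
  (∏ j ∈ u, ((b j : ℝ) - 1)⁻¹) * (n : ℝ)⁻¹ *
    ∑ i ∈ Finset.range n, ∑ i' ∈ Finset.range n,
      ∏ j ∈ u,
        ((b j : ℝ) *
            (if ⌊(b j : ℝ) ^ (k j + 1) * S i j⌋ = ⌊(b j : ℝ) ^ (k j + 1) * S i' j⌋
              then 1 else 0) -
          (if ⌊(b j : ℝ) ^ k j * S i j⌋ = ⌊(b j : ℝ) ^ k j * S i' j⌋ then 1 else 0))
/-- The number of ordered pairs of indices below `n` with the same value of `f`. -/
def pairCount {α : Type*} [DecidableEq α] (f : ℕ → α) (n : ℕ) : ℕ :=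
  ∑ i ∈ Finset.range n, ∑ i' ∈ Finset.range n, if f i = f i' then 1 else 0

/-- Every block of `m` consecutive indices starting at a multiple of `m` attains each value of `f`
exactly once. -/
def BlockBijective {α : Type*} (f : ℕ → α) (m : ℕ) : Prop :=
  ∀ R i, ∃! i', i' ∈ Finset.Ico (R * m) ((R + 1) * m) ∧ f i' = f i

namespace BlockBijective

variable {α : Type*} [DecidableEq α] {f : ℕ → α} {m : ℕ}

theorem sum_range_mul (h : BlockBijective f m) (i N : ℕ) :
    ∑ i' ∈ Finset.range (N * m), (if f i = f i' then 1 else 0) = N := by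
  induction N with
  | zero => simp
  | succ N ih =>
    rw [← Finset.sum_range_add_sum_Ico _ (Nat.mul_le_mul_right m N.le_succ), ih]
    obtain ⟨c, ⟨hc, hfc⟩, huniq⟩ := h N i
    rw [Finset.sum_eq_single_of_mem c hc fun e he hne =>
      if_neg fun hf => hne (huniq e ⟨he, hf.symm⟩), if_pos hfc.symm]

theorem sum_range_self (h : BlockBijective f m) (hm : 0 < m) (n : ℕ) :
    ∑ i' ∈ Finset.range n, (if f n = f i' then 1 else 0) = n / m := by
  have hle : n / m * m ≤ n := Nat.div_mul_le_self n m
  have hlt : n < (n / m + 1) * m := by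
    rw [mul_comm]
    exact Nat.lt_mul_div_succ n hm
  rw [← Finset.sum_range_add_sum_Ico _ hle, h.sum_range_mul, Finset.sum_eq_zero, add_zero]
  intro e he
  rw [Finset.mem_Ico] at he
  refine if_neg fun hf => he.2.ne ((h (n / m) n).unique ⟨?_, hf.symm⟩ ⟨?_, rfl⟩)
  · exact Finset.mem_Ico.2 ⟨he.1, he.2.trans hlt⟩
  · exact Finset.mem_Ico.2 ⟨hle, hlt⟩

theorem pairCount_succ (h : BlockBijective f m) (hm : 0 < m) (n : ℕ) :
    pairCount f (n + 1) = pairCount f n + 2 * (n / m) + 1 := by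
  have hsymm : ∑ i ∈ Finset.range n, (if f i = f n then 1 else 0) = n / m := by
    rw [← h.sum_range_self hm n]
    exact Finset.sum_congr rfl fun i _ => by simp only [eq_comm]
  simp only [pairCount, Finset.sum_range_succ, Finset.sum_add_distrib, hsymm,
    h.sum_range_self hm n, if_true]
  ring

theorem pairCount_mul_add (h : BlockBijective f m) (hm : 0 < m) (N n : ℕ) :
    pairCount f (N * m + n) = N ^ 2 * m + 2 * n * N + pairCount f n := by
  induction n with
  | zero =>
    simp [pairCount, h.sum_range_mul]
    ring
  | succ n ih =>
    rw [← add_assoc, h.pairCount_succ hm, h.pairCount_succ hm, ih, mul_comm N m,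
      Nat.mul_add_div hm]
    ring

end BlockBijective

section Resolution

variable {d : ℕ}

/-- The resolutions `k_j + χ(j ∈ v)` for `j ∈ u`, extended by `0` outside `u`. -/
def resolution (u v : Finset (Fin d)) (k : Fin d → ℕ) (j : Fin d) : ℕ :=
  if j ∈ u then k j + if j ∈ v then 1 else 0 else 0

theorem prod_pow_resolution (b : Fin d → ℕ) {u v : Finset (Fin d)} (hv : v ⊆ u)
    (k : Fin d → ℕ) : ∏ j, b j ^ resolution u v k j = mq b u v k := by
  have hout : ∀ j ∈ Finset.univ, j ∉ u → b j ^ resolution u v k j = 1 := fun j _ hj => by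
    simp [resolution, hj]
  rw [mq, ← Finset.prod_subset (Finset.subset_univ u) hout, ← Finset.prod_sdiff hv, mul_comm]
  congr 1
  · exact Finset.prod_congr rfl fun j hj => by simp [resolution, hv hj, hj]
  · refine Finset.prod_congr rfl fun j hj => ?_
    rw [Finset.mem_sdiff] at hj
    simp [resolution, hj.1, hj.2]

/-- The index of the elementary interval of resolution `k` containing the point `x_i`. -/
def cell (b : Fin d → ℕ) (S : ℕ → Fin d → ℝ) (k : Fin d → ℕ) (i : ℕ) (j : Fin d) : ℤ :=
  ⌊(b j : ℝ) ^ k j * S i j⌋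

theorem IsEquidistributed.blockBijective {b : Fin d → ℕ} (hb : ∀ j, 0 < b j)
    {S : ℕ → Fin d → ℝ} (hS : IsEquidistributed b S) (k : Fin d → ℕ) :
    BlockBijective (cell b S k) (∏ j, b j ^ k j) := by
  intro R i
  simp only [funext_iff]
  refine hS.2 R k (cell b S k i) fun j => ?_
  obtain ⟨h0, h1⟩ := hS.1 i j
  have hpos : (0 : ℝ) < (b j : ℝ) ^ k j := pow_pos (Nat.cast_pos.2 (hb j)) _
  refine ⟨Int.floor_nonneg.2 (mul_nonneg hpos.le h0), Int.floor_lt.2 ?_⟩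
  push_cast
  exact mul_lt_of_lt_one_right hpos h1

theorem Cq_eq_pairCount (b : Fin d → ℕ) {S : ℕ → Fin d → ℝ}
    (hS : ∀ i j, S i j ∈ Set.Ico (0 : ℝ) 1) (u v : Finset (Fin d)) (k : Fin d → ℕ) (n : ℕ) :
    Cq b S u v k n = pairCount (cell b S (resolution u v k)) n := by
  refine Finset.sum_congr rfl fun i _ => Finset.sum_congr rfl fun i' _ => if_congr ?_ rfl rfl
  rw [funext_iff]
  refine forall_congr' fun j => ?_
  by_cases hj : j ∈ u
  · simp [cell, resolution, hj]
  · simp [cell, resolution, hj, Int.floor_eq_zero_iff.2 (hS i j),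
      Int.floor_eq_zero_iff.2 (hS i' j)]

theorem mq_pos {b : Fin d → ℕ} (hb : ∀ j, 0 < b j) (u v : Finset (Fin d)) (k : Fin d → ℕ) :
    0 < mq b u v k :=
  Nat.mul_pos (Finset.prod_pos fun j _ => pow_pos (hb j) _)
    (Finset.prod_pos fun j _ => pow_pos (hb j) _)

theorem mq_dvd_mq_self (b : Fin d → ℕ) {u v : Finset (Fin d)} (hv : v ⊆ u) (k : Fin d → ℕ) :
    mq b u v k ∣ mq b u u k := by
  rw [← prod_pow_resolution b hv, ← prod_pow_resolution b (Finset.Subset.refl u)]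
  refine Finset.prod_dvd_prod_of_dvd _ _ fun j _ => pow_dvd_pow _ ?_
  unfold resolution
  split_ifs <;> simp

end Resolution

theorem statement18 {d : ℕ} (hd : 1 ≤ d) (b : Fin d → ℕ) (hb : ∀ j, 2 ≤ b j)
    (S : ℕ → Fin d → ℝ) (hS : IsEquidistributed b S)
    (u : Finset (Fin d)) (hu : u.Nonempty) (v : Finset (Fin d)) (hv : v ⊆ u)
    (k : Fin d → ℕ) (q r : ℕ) (hq : 1 ≤ q) (hr : r < mq b u u k) :
    (Cq b S u v k (q * mq b u u k + r) : ℝ) =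
      ((q : ℝ) ^ 2 * (mq b u u k : ℝ) ^ 2 + 2 * (r : ℝ) * (q : ℝ) * (mq b u u k : ℝ)) /
          (mq b u v k : ℝ) +
        (Cq b S u v k r : ℝ) := by
  have hb' : ∀ j, 0 < b j := fun j => two_pos.trans_le (hb j)
  have hm := mq_pos hb' u v k
  obtain ⟨t, ht⟩ := mq_dvd_mq_self b hv k
  have hblock := hS.blockBijective hb' (resolution u v k)
  rw [prod_pow_resolution b hv] at hblock
  have hm0 : (mq b u v k : ℝ) ≠ 0 := Nat.cast_ne_zero.2 hm.ne'
  rw [Cq_eq_pairCount b hS.1, Cq_eq_pairCount b hS.1, ht,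
    show q * (mq b u v k * t) = q * t * mq b u v k by ring, hblock.pairCount_mul_add hm]
  push_cast
  field_simp

end
end
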